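/- Let d ≥ 2 and let D ⊆ ℝ^d be a nonempty bounded open set. Let V : [0,∞) → [0,∞) be nondecreasing with V(0)=0, V(r) > 0 for r > 0, V(λr) ≤ λ V(r) for all λ ≥ 1, and suppose there are constants c₂ ≥ 1 and α₁ ≥ 1 with V(ηr) ≤ c₂ η^{α₁/2} V(r) for all 0 < η ≤ 1 and 0 < r ≤ diam(D). Define U(s) = V(s)²/s^d and H(x,y) = U(|x−y|) V(δ_D(x)) V(δ_D(y)) / V(r(x,y))². Then there is a constant C = C(d, c₂) such that for all pairwise distinct x, y, z ∈ D: H(x,z) H(z,y) / H(x,y) ≤ C · ( δ_D(z) ∧ |x−z| ∧ |y−z| ) · max( U(|x−z|)/|x−z| , U(|y−z|)/|y−z| ). -/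

import Mathlib

open Metric MeasureTheory Filter Set

noncomputable section

/-- `δ_D(x)`: the distance from `x` to the complement of `D`. -/
def deltaD {d : ℕ} (D : Set (EuclideanSpace ℝ (Fin d)))
    (x : EuclideanSpace ℝ (Fin d)) : ℝ :=
  Metric.infDist x Dᶜ

/-- `r(y,z) = max(δ_D(y), δ_D(z), |y − z|)`. -/
def rD {d : ℕ} (D : Set (EuclideanSpace ℝ (Fin d)))
    (y z : EuclideanSpace ℝ (Fin d)) : ℝ :=
  max (max (deltaD D y) (deltaD D z)) (dist y z)

/-- `U(s) = V(s)² / s^d`. -/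
def Ufun (d : ℕ) (V : ℝ → ℝ) (s : ℝ) : ℝ :=
  (V s) ^ 2 / s ^ d

/-- `H(x,y) = U(|x−y|) · V(δ_D(x)) V(δ_D(y)) / V(r(x,y))²`. -/
def Hfun {d : ℕ} (V : ℝ → ℝ) (D : Set (EuclideanSpace ℝ (Fin d)))
    (x y : EuclideanSpace ℝ (Fin d)) : ℝ :=
  Ufun d V (dist x y) * (V (deltaD D x) * V (deltaD D y)) / (V (rD D x y)) ^ 2


lemma U_le {d : ℕ} (hd : 2 ≤ d) (V : ℝ → ℝ)
    (hm : ∀ r s : ℝ, 0 ≤ r → r ≤ s → V r ≤ V s)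
    (hp : ∀ r : ℝ, 0 < r → 0 < V r)
    (hl : ∀ lam r : ℝ, 1 ≤ lam → 0 ≤ r → V (lam * r) ≤ lam * V r)
    {b c : ℝ} (hb : 0 < b) (hc : 0 < c) (hcb : c ≤ 2 * b) :
    Ufun d V b ≤ 2 ^ d * Ufun d V c := by
  unfold Ufun
  have hVb := hp b hb
  have hVc := hp c hc
  rw [← mul_div_assoc, div_le_div_iff₀ (by positivity) (by positivity)]
  rcases le_total c b with h | h
  · have h1 : V b ≤ b / c * V c := by
      have := hl (b / c) c ((one_le_div hc).2 h) hc.le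
      rwa [div_mul_cancel₀ _ hc.ne'] at this
    have h2 : V b * c ≤ b * V c := by
      calc V b * c ≤ (b / c * V c) * c := by gcongr
        _ = b * V c := by field_simp
    obtain ⟨k, rfl⟩ := Nat.exists_eq_add_of_le hd
    calc V b ^ 2 * c ^ (2 + k) = (V b * c) ^ 2 * c ^ k := by ring
      _ ≤ (b * V c) ^ 2 * b ^ k := by gcongr
      _ = 1 * (V c ^ 2 * b ^ (2 + k)) := by ring
      _ ≤ 2 ^ (2 + k) * (V c ^ 2 * b ^ (2 + k)) := by
        gcongr
        exact one_le_pow₀ (by norm_num)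
      _ = _ := by ring
  · have h1 := hm b c hb.le h
    calc V b ^ 2 * c ^ d ≤ V c ^ 2 * (2 * b) ^ d := by gcongr
      _ = _ := by rw [mul_pow]; ring

lemma core {d : ℕ} (hd : 2 ≤ d) (c₂ : ℝ) (hc₂ : 1 ≤ c₂) (V : ℝ → ℝ)
    (hm : ∀ r s : ℝ, 0 ≤ r → r ≤ s → V r ≤ V s)
    (hp : ∀ r : ℝ, 0 < r → 0 < V r)
    (hl : ∀ lam r : ℝ, 1 ≤ lam → 0 ≤ r → V (lam * r) ≤ lam * V r)
    (α : ℝ) (hα : 1 ≤ α) (R : ℝ)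
    (hs : ∀ η r : ℝ, 0 < η → η ≤ 1 → 0 < r → r ≤ R →
          V (η * r) ≤ c₂ * η ^ (α / 2) * V r)
    {a b c p q t r1 r2 r3 : ℝ} (ha : 0 < a) (hb : 0 < b) (hc : 0 < c) (hP : 0 < p)
    (hq : 0 < q) (ht : 0 < t) (hab : a ≤ b) (hcb : c ≤ 2 * b) (haR : a ≤ R)
    (h1a : a ≤ r1) (h1t : t ≤ r1) (h3 : 0 < r3) (h32 : r3 ≤ 2 * r2) :
    (Ufun d V a * (V p * V t) / V r1 ^ 2) * (Ufun d V b * (V t * V q) / V r2 ^ 2) /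
      (Ufun d V c * (V p * V q) / V r3 ^ 2) ≤
      (2 ^ d * 4 * c₂ ^ 2) * (min t (min a b)) * (Ufun d V a / a) := by
  have hU := U_le hd V hm hp hl hb hc hcb
  have hUp : ∀ s : ℝ, 0 < s → 0 < Ufun d V s := fun s hs => by
    have := hp s hs
    unfold Ufun; positivity
  have hr2 : 0 < r2 := by linarith
  have hVp := hp p hP
  have hVq := hp q hq
  have hVt := hp t ht
  have hV1 := hp r1 (by linarith)
  have hV2 := hp r2 hr2
  have hV3 := hp r3 h3
  have hUa := hUp a ha
  have hUb := hUp b hb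
  have hUc := hUp c hc
  have h4 : V r3 ≤ 2 * V r2 :=
    (hm _ _ h3.le h32).trans (hl 2 r2 (by norm_num) hr2.le)
  have key : (V t / V r1) ^ 2 ≤ c₂ ^ 2 * (min t a / a) := by
    rcases le_total a t with h | h
    · rw [min_eq_right h, div_self ha.ne', mul_one]
      have : V t / V r1 ≤ 1 := (div_le_one hV1).2 (hm _ _ ht.le h1t)
      have h0 : 0 ≤ V t / V r1 := by positivity
      nlinarith
    · rw [min_eq_left h]
      have hη : 0 < t / a := by positivity
      have hη1 : t / a ≤ 1 := (div_le_one ha).2 h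
      have e := hs (t / a) a hη hη1 ha haR
      rw [div_mul_cancel₀ _ ha.ne'] at e
      have e2 : V t / V r1 ≤ c₂ * (t / a) ^ (α / 2) := by
        rw [div_le_iff₀ hV1]
        refine e.trans ?_
        have := hm _ _ ha.le h1a
        gcongr
      have e3 : ((t / a) ^ (α / 2)) ^ 2 ≤ t / a := by
        rw [← Real.rpow_natCast, ← Real.rpow_mul hη.le]
        calc (t / a) ^ (α / 2 * ((2 : ℕ) : ℝ)) ≤ (t / a) ^ (1 : ℝ) :=
              Real.rpow_le_rpow_of_exponent_ge hη hη1 (by push_cast; linarith)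
          _ = t / a := Real.rpow_one _
      calc (V t / V r1) ^ 2 ≤ (c₂ * (t / a) ^ (α / 2)) ^ 2 := by gcongr
        _ = c₂ ^ 2 * ((t / a) ^ (α / 2)) ^ 2 := by ring
        _ ≤ _ := by gcongr
  rw [min_eq_left hab]
  have hA : Ufun d V b / Ufun d V c ≤ 2 ^ d := (div_le_iff₀ hUc).2 hU
  have hB : V r3 / V r2 ≤ 2 := (div_le_iff₀ hV2).2 h4
  calc _ = Ufun d V a * (Ufun d V b / Ufun d V c) * (V r3 / V r2) ^ 2 * (V t / V r1) ^ 2 := by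
        field_simp
    _ ≤ Ufun d V a * 2 ^ d * 2 ^ 2 * (c₂ ^ 2 * (min t a / a)) := by gcongr
    _ = _ := by ring

lemma rD_comm {d : ℕ} (D : Set (EuclideanSpace ℝ (Fin d)))
    (x y : EuclideanSpace ℝ (Fin d)) : rD D x y = rD D y x := by
  unfold rD; rw [dist_comm, max_comm (deltaD D x)]

lemma Hfun_comm {d : ℕ} (V : ℝ → ℝ) (D : Set (EuclideanSpace ℝ (Fin d)))
    (x y : EuclideanSpace ℝ (Fin d)) : Hfun V D x y = Hfun V D y x := by
  unfold Hfun; rw [dist_comm, rD_comm, mul_comm (V (deltaD D x))]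

/-- Inequality (3.6): the 3G theorem combined with the scaling estimate for `V`. -/
theorem threeG_with_scaling {d : ℕ} (hd : 2 ≤ d) (c₂ : ℝ) (hc₂ : 1 ≤ c₂) :
    ∃ C : ℝ, 0 < C ∧
      ∀ (D : Set (EuclideanSpace ℝ (Fin d))), D.Nonempty → IsOpen D →
        Bornology.IsBounded D →
      ∀ V : ℝ → ℝ,
        (∀ r s : ℝ, 0 ≤ r → r ≤ s → V r ≤ V s) →
        V 0 = 0 →
        (∀ r : ℝ, 0 < r → 0 < V r) →
        (∀ lam r : ℝ, 1 ≤ lam → 0 ≤ r → V (lam * r) ≤ lam * V r) →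
      ∀ α₁ : ℝ, 1 ≤ α₁ →
        (∀ η r : ℝ, 0 < η → η ≤ 1 → 0 < r → r ≤ Metric.diam D →
          V (η * r) ≤ c₂ * η ^ (α₁ / 2) * V r) →
      ∀ x y z : EuclideanSpace ℝ (Fin d), x ∈ D → y ∈ D → z ∈ D →
        x ≠ y → x ≠ z → y ≠ z →
        Hfun V D x z * Hfun V D z y / Hfun V D x y ≤
          C * (min (deltaD D z) (min (dist x z) (dist y z))) *
            max (Ufun d V (dist x z) / dist x z) (Ufun d V (dist y z) / dist y z) := by
  refine ⟨2 ^ d * 4 * c₂ ^ 2, by positivity, ?_⟩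
  intro D hne hD hbd V hm _ hp hl α hα hs
  have hδ : ∀ x ∈ D, 0 < deltaD D x := by
    intro x hx
    have hcn : (Dᶜ).Nonempty := by
      haveI : Nonempty (Fin d) := ⟨⟨0, by omega⟩⟩
      rw [Set.nonempty_compl]
      rintro rfl
      exact NoncompactSpace.noncompact_univ (X := EuclideanSpace ℝ (Fin d))
        (Metric.isCompact_of_isClosed_isBounded isClosed_univ hbd)
    exact (hD.isClosed_compl.notMem_iff_infDist_pos hcn).1 (by simpa using hx)
  have main : ∀ x y z : EuclideanSpace ℝ (Fin d), x ∈ D → y ∈ D → z ∈ D →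
        x ≠ y → x ≠ z → y ≠ z → dist x z ≤ dist y z →
        Hfun V D x z * Hfun V D z y / Hfun V D x y ≤
          (2 ^ d * 4 * c₂ ^ 2) * (min (deltaD D z) (min (dist x z) (dist y z))) *
            (Ufun d V (dist x z) / dist x z) := by
    intro x y z hx hy hz hxy hxz hyz hab
    have hc : dist x y ≤ dist x z + dist y z := dist_triangle_right _ _ _
    have hpt : deltaD D x ≤ deltaD D z + dist x z := Metric.infDist_le_infDist_add_dist
    have hzy : dist z y = dist y z := dist_comm _ _
    have a1 : deltaD D z ≤ rD D z y := (le_max_left _ _).trans (le_max_left _ _)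
    have a2 : deltaD D y ≤ rD D z y := (le_max_right _ _).trans (le_max_left _ _)
    have a3 : dist y z ≤ rD D z y := hzy ▸ le_max_right _ _
    have hy0 := hδ y hy
    have h := core hd c₂ hc₂ V hm hp hl α hα (Metric.diam D) hs
      (a := dist x z) (b := dist y z) (c := dist x y) (p := deltaD D x) (q := deltaD D y)
      (t := deltaD D z) (r1 := rD D x z) (r2 := rD D z y) (r3 := rD D x y)
      (dist_pos.2 hxz) (dist_pos.2 hyz) (dist_pos.2 hxy) (hδ x hx) (hδ y hy) (hδ z hz) hab
      (by linarith) (Metric.dist_le_diam_of_mem hbd hx hz) (le_max_right _ _)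
      ((le_max_right _ _).trans (le_max_left _ _))
      ((dist_pos.2 hxy).trans_le (le_max_right _ _))
      (max_le (max_le (by linarith) (by linarith)) (by linarith))
    unfold Hfun
    rw [hzy]
    exact h
  intro x y z hx hy hz hxy hxz hyz
  have hmn : 0 ≤ min (deltaD D z) (min (dist x z) (dist y z)) :=
    le_min (hδ z hz).le (le_min dist_nonneg dist_nonneg)
  rcases le_total (dist x z) (dist y z) with h | h
  · exact (main x y z hx hy hz hxy hxz hyz h).trans
      (mul_le_mul_of_nonneg_left (le_max_left _ _) (by positivity))
  · have := main y x z hy hx hz hxy.symm hyz hxz h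
    rw [Hfun_comm V D y z, Hfun_comm V D z x, Hfun_comm V D y x, mul_comm (Hfun V D z y),
      min_comm (dist y z)] at this
    exact this.trans (mul_le_mul_of_nonneg_left (le_max_right _ _) (by positivity))


end
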